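/- arXiv:2502.06832 — 3 statements merged into one kernel-verified Lean document; each statement's English description precedes it below -/
import Mathlib

section
/- (Certified robustness bound for a single MoE.) Let I be a finite index set, V a real normed vector space, c ≥ 1 the number of classes, a_i : V → ℝ router weights and f_i : V → ℝ^c experts for i in I, and let F(z) = Σ_{i∈I} a_i(z)·f_i(z) (componentwise). Fix an input x in V and a class y, and assume: (i) a_i(x) ≥ 0 for all i; (ii) each a_i is r_i-Lipschitz: |a_i(z') − a_i(z)| ≤ r_i·‖z' − z‖ for all z, z'; (iii) for every class k ≠ y, the class-difference function f_i^{(y)} − f_i^{(k)} is L_i-Lipschitz and satisfies |f_i^{(y)}(z) − f_i^{(k)}(z)| ≤ M_i for all z; (iv) the denominator D = Σ_{i∈I} (r_i·M_i + a_i(x)·L_i) is strictly positive; (v) F^{(y)}(x) ≥ F^{(k)}(x) for all k ≠ y. Define ε = min_{k ≠ y} (F^{(y)}(x) − F^{(k)}(x)) / D. Then for every δ in V with ‖δ‖ ≤ ε and every class k ≠ y, F^{(y)}(x + δ) ≥ F^{(k)}(x + δ). -/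
/-- If a weight moves by at most `p` and a value bounded by `M` moves by at most `q`, then the
product of a nonnegative weight with the value decreases by at most `p * M + w * q`. -/
theorem mul_sub_mul_le_of_abs_sub_le {w w' d d' p q M : ℝ} (hw : 0 ≤ w)
    (hww : |w' - w| ≤ p) (hdd : |d' - d| ≤ q) (hd : |d'| ≤ M) :
    w * d - w' * d' ≤ p * M + w * q := by
  have h₁ : -((w' - w) * d') ≤ p * M :=
    (neg_le_abs _).trans <| (abs_mul _ _).trans_le <|
      mul_le_mul hww hd (abs_nonneg _) ((abs_nonneg _).trans hww)
  have h₂ : w * (d - d') ≤ w * q :=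
    mul_le_mul_of_nonneg_left ((le_abs_self _).trans (abs_sub_comm d d' ▸ hdd)) hw
  linarith


/-- Certified robustness bound for a single Mixture of Experts
`F z = Σ_i a i z • f i z` (componentwise): for every perturbation `δ` with
`‖δ‖ ≤ ε = min_{k ≠ y} (F^{(y)}(x) - F^{(k)}(x)) / (Σ_i (r i * M i + a i x * L i))`
(expressed by requiring `‖δ‖` to be at most each of the quantities whose minimum defines `ε`),
the prediction `y` is preserved: `F^{(y)}(x + δ) ≥ F^{(k)}(x + δ)` for all `k ≠ y`. -/
theorem single_moe_certified_robustness
    {I : Type*} [Fintype I] {V : Type*} [NormedAddCommGroup V] [NormedSpace ℝ V]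
    (c : ℕ) (hc : 1 ≤ c)
    (a : I → V → ℝ) (f : I → V → Fin c → ℝ)
    (r L M : I → ℝ)
    (F : V → Fin c → ℝ) (hF : ∀ (z : V) (j : Fin c), F z j = ∑ i, a i z * f i z j)
    (x : V) (y : Fin c)
    (ha0 : ∀ i, 0 ≤ a i x)
    (haLip : ∀ i, ∀ z z' : V, |a i z' - a i z| ≤ r i * ‖z' - z‖)
    (hfLip : ∀ i, ∀ k, k ≠ y → ∀ z z' : V,
      |(f i z' y - f i z' k) - (f i z y - f i z k)| ≤ L i * ‖z' - z‖)
    (hfB : ∀ i, ∀ k, k ≠ y → ∀ z : V, |f i z y - f i z k| ≤ M i)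
    (hD : 0 < ∑ i, (r i * M i + a i x * L i))
    (hmargin : ∀ k, k ≠ y → F x k ≤ F x y)
    (δ : V)
    (hδ : ∀ k, k ≠ y →
      ‖δ‖ ≤ (F x y - F x k) / ∑ i, (r i * M i + a i x * L i)) :
    ∀ k, k ≠ y → F (x + δ) k ≤ F (x + δ) y := by
  intro k hk
  have hdiff (z : V) : F z y - F z k = ∑ i, a i z * (f i z y - f i z k) := by
    simp only [hF, mul_sub, Finset.sum_sub_distrib]
  have hdrop : (F x y - F x k) - (F (x + δ) y - F (x + δ) k) ≤
      ‖δ‖ * ∑ i, (r i * M i + a i x * L i) := by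
    rw [hdiff, hdiff, ← Finset.sum_sub_distrib, Finset.mul_sum]
    refine Finset.sum_le_sum fun i _ ↦ ?_
    have ha := haLip i x (x + δ)
    have hf := hfLip i k hk x (x + δ)
    rw [add_sub_cancel_left] at ha hf
    linarith [mul_sub_mul_le_of_abs_sub_le (ha0 i) ha hf (hfB i k hk (x + δ))]
  linarith [(le_div_iff₀ hD).mp (hδ k hk)]
end

section
/- (Certified robustness bound for the dual-model.) Let I be a finite index set, V a real normed vector space, c ≥ 1 the number of classes. Let F_S : V → ℝ^c be any function with 0 ≤ F_S^{(j)}(z) ≤ 1 for every class j and every z in V. Let F_R(z) = Σ_{i∈I} a_i(z)·f_i(z) (componentwise) be an MoE with: (i) a_i(x) ≥ 0 at a fixed input x; (ii) each a_i r_i-Lipschitz; (iii) each coordinate f_i^{(j)} of each expert L_i^{(j)}-Lipschitz with 0 ≤ f_i^{(j)}(z) ≤ 1 for all z. Let α ∈ [1/2, 1] and define the dual-model F_D(z) = (1 − α)·F_S(z) + α·F_R(z). Fix a class y, assume for every k ≠ y the denominator D_k = Σ_{i∈I} (2·r_i + a_i(x)·(L_i^{(y)} + L_i^{(k)})) is strictly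 positive, and define ε = min_{k ≠ y} (α·(F_R^{(y)}(x) − F_R^{(k)}(x)) + α − 1) / (α·D_k). Then for every δ in V with ‖δ‖ ≤ ε and every class k ≠ y, F_D^{(y)}(x + δ) ≥ F_D^{(k)}(x + δ). -/
/-- If `a` and `a'` differ by at most `ρ`, `|u'| ≤ 1`, and `u`, `u'` differ by at most `σ`, then
the product `a * u` drops by at most `ρ + a * σ`. -/
theorem mul_sub_le_mul_of_abs_sub_le {a a' u u' ρ σ : ℝ} (ha : 0 ≤ a) (haa' : |a' - a| ≤ ρ)
    (hu' : |u'| ≤ 1) (huu' : |u' - u| ≤ σ) : a * u - (ρ + a * σ) ≤ a' * u' := by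
  have h₁ : |(a' - a) * u'| ≤ ρ := by
    rw [abs_mul]
    exact (mul_le_of_le_one_right (abs_nonneg _) hu').trans haa'
  have h₂ : a * (u - u') ≤ a * σ :=
    mul_le_mul_of_nonneg_left ((le_abs_self _).trans (abs_sub_comm u u' ▸ huu')) ha
  linarith [neg_le_of_abs_le h₁]


/-- Certified robustness bound for the dual-model
`F_D z = (1 - α) • F_S z + α • F_R z`, where `F_R z = Σ_i a i z • f i z` is an MoE:
for every perturbation `δ` with
`‖δ‖ ≤ ε = min_{k ≠ y} (α (F_R^{(y)}(x) - F_R^{(k)}(x)) + α - 1) / (α Σ_i (2 r i + a i x (L i y + L i k)))`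
(expressed by requiring `‖δ‖` to be at most each quantity whose minimum defines `ε`),
the prediction `y` is preserved: `F_D^{(y)}(x + δ) ≥ F_D^{(k)}(x + δ)` for all `k ≠ y`. -/
theorem dual_model_certified_robustness
    {I : Type*} [Fintype I] {V : Type*} [NormedAddCommGroup V] [NormedSpace ℝ V]
    (c : ℕ) (hc : 1 ≤ c)
    (FS : V → Fin c → ℝ)
    (hFS : ∀ (z : V) (j : Fin c), 0 ≤ FS z j ∧ FS z j ≤ 1)
    (a : I → V → ℝ) (f : I → V → Fin c → ℝ)
    (r : I → ℝ) (L : I → Fin c → ℝ)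
    (FR : V → Fin c → ℝ)
    (hFR : ∀ (z : V) (j : Fin c), FR z j = ∑ i, a i z * f i z j)
    (x : V)
    (ha0 : ∀ i, 0 ≤ a i x)
    (haLip : ∀ i, ∀ z z' : V, |a i z' - a i z| ≤ r i * ‖z' - z‖)
    (hfLip : ∀ i (j : Fin c), ∀ z z' : V, |f i z' j - f i z j| ≤ L i j * ‖z' - z‖)
    (hfB : ∀ i (j : Fin c), ∀ z : V, 0 ≤ f i z j ∧ f i z j ≤ 1)
    (α : ℝ) (hα : α ∈ Set.Icc (1 / 2 : ℝ) 1)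
    (FD : V → Fin c → ℝ)
    (hFD : ∀ (z : V) (j : Fin c), FD z j = (1 - α) * FS z j + α * FR z j)
    (y : Fin c)
    (hD : ∀ k, k ≠ y → 0 < ∑ i, (2 * r i + a i x * (L i y + L i k)))
    (δ : V)
    (hδ : ∀ k, k ≠ y →
      ‖δ‖ ≤ (α * (FR x y - FR x k) + α - 1) /
        (α * ∑ i, (2 * r i + a i x * (L i y + L i k)))) :
    ∀ k, k ≠ y → FD (x + δ) k ≤ FD (x + δ) y := by
  intro k hk
  obtain ⟨hα₁, hα₂⟩ := hα
  have hα₀ : 0 < α := by linarith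
  have hradius := (le_div_iff₀ (mul_pos hα₀ (hD k hk))).mp (hδ k hk)
  have hterm (i : I) :
      a i x * (f i x y - f i x k) - ‖δ‖ * (2 * r i + a i x * (L i y + L i k)) ≤
        a i (x + δ) * (f i (x + δ) y - f i (x + δ) k) := by
    have ha := haLip i x (x + δ)
    have hy := hfLip i y x (x + δ)
    have hk := hfLip i k x (x + δ)
    rw [add_sub_cancel_left] at ha hy hk
    have hr : 0 ≤ r i * ‖δ‖ := (abs_nonneg _).trans ha
    have hgap : |f i (x + δ) y - f i (x + δ) k| ≤ 1 :=
      abs_sub_le_of_nonneg_of_le (hfB i y _).1 (hfB i y _).2 (hfB i k _).1 (hfB i k _).2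
    have hdiff : |(f i (x + δ) y - f i (x + δ) k) - (f i x y - f i x k)| ≤
        L i y * ‖δ‖ + L i k * ‖δ‖ := by
      rw [sub_sub_sub_comm]
      exact (abs_sub _ _).trans (add_le_add hy hk)
    linarith [mul_sub_le_mul_of_abs_sub_le (ha0 i) ha hgap hdiff]
  have hmargin (z : V) : FR z y - FR z k = ∑ i, a i z * (f i z y - f i z k) := by
    simp only [hFR, mul_sub, Finset.sum_sub_distrib]
  have hsum := Finset.sum_le_sum fun i (_ : i ∈ Finset.univ) => hterm i
  rw [Finset.sum_sub_distrib, ← Finset.mul_sum, ← hmargin, ← hmargin] at hsum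
  have hrobust := mul_le_mul_of_nonneg_left hsum hα₀.le
  have hstandard : (1 - α) * (FS (x + δ) k - FS (x + δ) y) ≤ 1 - α :=
    mul_le_of_le_one_right (by linarith)
      (by linarith [(hFS (x + δ) k).2, (hFS (x + δ) y).1])
  rw [hFD, hFD]
  linarith
end

section
/- Let I be a finite index set, V a real normed vector space, a_i : V → ℝ router weights and f_i^{(y)}, f_i^{(k)} : V → ℝ two output coordinates of each expert i. Fix x in V and assume: (i) a_i(x) ≥ 0; (ii) each a_i is r_i-Lipschitz; (iii) f_i^{(y)} is L_i^{(y)}-Lipschitz and f_i^{(k)} is L_i^{(k)}-Lipschitz; (iv) 0 ≤ f_i^{(y)}(z) ≤ 1 and 0 ≤ f_i^{(k)}(z) ≤ 1 for all z in V. Let G(z) = Σ_{i∈I} a_i(z)·(f_i^{(y)}(z) − f_i^{(k)}(z)). Then for every δ in V, |G(x + δ) − G(x)| ≤ (Σ_{i∈I} (2·r_i + a_i(x)·(L_i^{(y)} + L_i^{(k)})))·‖δ‖. -/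
/-- Change bound on the class-score difference
`G z = Σ_i a i z * (f_i^{(y)} z - f_i^{(k)} z)` of an MoE, with expert coordinates in
`[0, 1]`: `|G (x+δ) - G x| ≤ (Σ_i (2 r i + a i x * (Ly i + Lk i))) * ‖δ‖`. -/
theorem moe_class_difference_change_bound
    {I : Type*} [Fintype I] {V : Type*} [NormedAddCommGroup V] [NormedSpace ℝ V]
    (a : I → V → ℝ) (fy fk : I → V → ℝ)
    (r Ly Lk : I → ℝ) (x : V)
    (ha0 : ∀ i, 0 ≤ a i x)
    (haLip : ∀ i, ∀ z z' : V, |a i z' - a i z| ≤ r i * ‖z' - z‖)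
    (hfyLip : ∀ i, ∀ z z' : V, |fy i z' - fy i z| ≤ Ly i * ‖z' - z‖)
    (hfkLip : ∀ i, ∀ z z' : V, |fk i z' - fk i z| ≤ Lk i * ‖z' - z‖)
    (hfyB : ∀ i, ∀ z : V, 0 ≤ fy i z ∧ fy i z ≤ 1)
    (hfkB : ∀ i, ∀ z : V, 0 ≤ fk i z ∧ fk i z ≤ 1)
    (G : V → ℝ) (hG : ∀ z : V, G z = ∑ i, a i z * (fy i z - fk i z))
    (δ : V) :
    |G (x + δ) - G x| ≤ (∑ i, (2 * r i + a i x * (Ly i + Lk i))) * ‖δ‖ := by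
  rw [hG, hG, ← Finset.sum_sub_distrib, Finset.sum_mul]
  refine (Finset.abs_sum_le_sum_abs _ _).trans (Finset.sum_le_sum fun i _ => ?_)
  have ha := haLip i x (x + δ)
  have hy := hfyLip i x (x + δ)
  have hk := hfkLip i x (x + δ)
  rw [add_sub_cancel_left] at ha hy hk
  have hd : |fy i (x + δ) - fk i (x + δ)| ≤ 2 := by
    obtain ⟨hy0, hy1⟩ := hfyB i (x + δ)
    obtain ⟨hk0, hk1⟩ := hfkB i (x + δ)
    rw [abs_le]
    constructor <;> linarith
  have hdiff : |(fy i (x + δ) - fy i x) - (fk i (x + δ) - fk i x)| ≤ Ly i * ‖δ‖ + Lk i * ‖δ‖ :=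
    (abs_sub _ _).trans (add_le_add hy hk)
  calc |a i (x + δ) * (fy i (x + δ) - fk i (x + δ)) - a i x * (fy i x - fk i x)|
      = |(a i (x + δ) - a i x) * (fy i (x + δ) - fk i (x + δ))
          + a i x * ((fy i (x + δ) - fy i x) - (fk i (x + δ) - fk i x))| := by
        congr 1
        ring
    _ ≤ |a i (x + δ) - a i x| * |fy i (x + δ) - fk i (x + δ)|
          + a i x * |(fy i (x + δ) - fy i x) - (fk i (x + δ) - fk i x)| := by
        refine (abs_add_le _ _).trans_eq ?_
        rw [abs_mul, abs_mul, abs_of_nonneg (ha0 i)]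
    _ ≤ r i * ‖δ‖ * 2 + a i x * (Ly i * ‖δ‖ + Lk i * ‖δ‖) :=
        add_le_add (mul_le_mul ha hd (abs_nonneg _) ((abs_nonneg _).trans ha))
          (mul_le_mul_of_nonneg_left hdiff (ha0 i))
    _ = (2 * r i + a i x * (Ly i + Lk i)) * ‖δ‖ := by ring
end
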